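/- (Lemma 2, quadratic maximization identity.) Let x ∈ ℝⁿ, y ∈ ℝ^m, let A ∈ ℝ^{n×m} be a matrix, let X ∈ ℝ^{n×n} and Y ∈ ℝ^{m×m} be symmetric positive definite, and let γ > 0 be such that Aᵀ X⁻¹ A − γ² Y⁻¹ ≺ 0. Then the function v ↦ |x − A v|²_{X⁻¹} − γ² |y − v|²_{Y⁻¹} attains its maximum over v ∈ ℝ^m, and max_{v ∈ ℝ^m} ( |x − A v|²_{X⁻¹} − γ² |y − v|²_{Y⁻¹} ) = |x − A y|²_{(X − γ⁻² A Y Aᵀ)⁻¹}. -/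

import Mathlib

open Matrix

/-- Weighted squared norm `|z|²_M = zᵀ M z`. -/
noncomputable def qf {k : ℕ} (M : Matrix (Fin k) (Fin k) ℝ) (z : Fin k → ℝ) : ℝ :=
  z ⬝ᵥ M *ᵥ z

theorem qf_add {k : ℕ} {M : Matrix (Fin k) (Fin k) ℝ} (hM : M.IsSymm) (a b : Fin k → ℝ) :
    qf M (a + b) = qf M a + 2 * (a ⬝ᵥ M *ᵥ b) + qf M b := by
  have hba : b ⬝ᵥ M *ᵥ a = a ⬝ᵥ M *ᵥ b := by
    rw [dotProduct_mulVec, ← mulVec_transpose, hM.eq, dotProduct_comm]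
  simp only [qf, mulVec_add, dotProduct_add, add_dotProduct, hba]
  ring

theorem qf_neg {k : ℕ} (M : Matrix (Fin k) (Fin k) ℝ) (a : Fin k → ℝ) :
    qf M (-a) = qf M a := by
  simp [qf, mulVec_neg]

theorem qf_mulVec {k l : ℕ} (M : Matrix (Fin k) (Fin k) ℝ) (A : Matrix (Fin k) (Fin l) ℝ)
    (w : Fin l → ℝ) : qf M (A *ᵥ w) = qf (Aᵀ * M * A) w := by
  simp only [qf, ← mulVec_mulVec]
  rw [dotProduct_mulVec w, vecMul_transpose]

theorem qf_nonneg {k : ℕ} {M : Matrix (Fin k) (Fin k) ℝ} (hM : M.PosDef) (z : Fin k → ℝ) :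
    0 ≤ qf M z := by
  simpa [qf] using hM.posSemidef.dotProduct_mulVec_nonneg z

theorem isSymm_of_posDef {k : ℕ} {M : Matrix (Fin k) (Fin k) ℝ} (hM : M.PosDef) : M.IsSymm := by
  simpa [IsHermitian, IsSymm] using hM.isHermitian

/-- A case of the Woodbury identity. -/
theorem inv_sub_smul_mul_mul_transpose {n m : ℕ} (A : Matrix (Fin n) (Fin m) ℝ)
    {X : Matrix (Fin n) (Fin n) ℝ} {Y : Matrix (Fin m) (Fin m) ℝ}
    (hX : IsUnit X.det) (hY : IsUnit Y.det) {c : ℝ} (hc : c ≠ 0)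
    (hH : IsUnit (c • Y⁻¹ - Aᵀ * X⁻¹ * A).det) :
    (X - c⁻¹ • (A * Y * Aᵀ))⁻¹ =
      X⁻¹ + X⁻¹ * A * (c • Y⁻¹ - Aᵀ * X⁻¹ * A)⁻¹ * (Aᵀ * X⁻¹) := by
  set H := c • Y⁻¹ - Aᵀ * X⁻¹ * A with hHdef
  apply inv_eq_right_inv
  have hG : Aᵀ * X⁻¹ * A = c • Y⁻¹ - H := by rw [hHdef]; abel
  have hA : Aᵀ * (X⁻¹ + X⁻¹ * A * H⁻¹ * (Aᵀ * X⁻¹)) = c • (Y⁻¹ * (H⁻¹ * (Aᵀ * X⁻¹))) := by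
    calc _ = Aᵀ * X⁻¹ + Aᵀ * X⁻¹ * A * (H⁻¹ * (Aᵀ * X⁻¹)) := by
          simp only [Matrix.mul_add, Matrix.mul_assoc]
      _ = _ := by
          rw [hG, Matrix.sub_mul, mul_nonsing_inv_cancel_left _ _ hH, smul_mul]
          abel
  rw [Matrix.sub_mul, smul_mul, Matrix.mul_assoc (A * Y), hA, Matrix.mul_smul, smul_smul,
    inv_mul_cancel₀ hc, one_smul, Matrix.mul_assoc A, mul_nonsing_inv_cancel_left _ _ hY,
    Matrix.mul_add, mul_nonsing_inv _ hX, Matrix.mul_assoc X⁻¹, Matrix.mul_assoc X⁻¹,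
    mul_nonsing_inv_cancel_left _ _ hX, Matrix.mul_assoc A, add_sub_cancel_right]

theorem sub_qf_eq_sub_qf_completed_square {n m : ℕ} (x : Fin n → ℝ) (y v : Fin m → ℝ)
    (A : Matrix (Fin n) (Fin m) ℝ)
    {X : Matrix (Fin n) (Fin n) ℝ} {Y : Matrix (Fin m) (Fin m) ℝ}
    (hX : X.PosDef) (hY : Y.PosDef) {c : ℝ} (hc : c ≠ 0)
    (hH : (c • Y⁻¹ - Aᵀ * X⁻¹ * A).PosDef) :
    qf X⁻¹ (x - A *ᵥ v) - c * qf Y⁻¹ (y - v) =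
      qf (X - c⁻¹ • (A * Y * Aᵀ))⁻¹ (x - A *ᵥ y) -
        qf (c • Y⁻¹ - Aᵀ * X⁻¹ * A)
          (v - y + (c • Y⁻¹ - Aᵀ * X⁻¹ * A)⁻¹ *ᵥ ((Aᵀ * X⁻¹) *ᵥ (x - A *ᵥ y))) := by
  have hdet := (isUnit_iff_isUnit_det _).1 hH.isUnit
  rw [inv_sub_smul_mul_mul_transpose A ((isUnit_iff_isUnit_det _).1 hX.isUnit)
    ((isUnit_iff_isUnit_det _).1 hY.isUnit) hc hdet, qf_add (isSymm_of_posDef hH)]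
  have hXs := isSymm_of_posDef hX.inv
  have hv : x - A *ᵥ v = -(A *ᵥ (v - y)) + (x - A *ᵥ y) := by
    rw [mulVec_sub]; abel
  have hy : y - v = -(v - y) := by abel
  rw [hv, hy, qf_add hXs, qf_neg, qf_neg, qf_mulVec]
  generalize x - A *ᵥ y = z
  generalize v - y = w
  have hw : qf (c • Y⁻¹ - Aᵀ * X⁻¹ * A) w = c * qf Y⁻¹ w - qf (Aᵀ * X⁻¹ * A) w := by
    simp [qf, sub_mulVec, smul_mulVec]
  rw [hw]
  generalize c • Y⁻¹ - Aᵀ * X⁻¹ * A = H at *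
  have hcross : A *ᵥ w ⬝ᵥ X⁻¹ *ᵥ z = w ⬝ᵥ (Aᵀ * X⁻¹) *ᵥ z := by
    rw [← mulVec_mulVec, dotProduct_mulVec w, vecMul_transpose]
  have hHb (b : Fin m → ℝ) : H *ᵥ (H⁻¹ *ᵥ b) = b := by
    rw [mulVec_mulVec, mul_nonsing_inv _ hdet, one_mulVec]
  have hS : qf (X⁻¹ + X⁻¹ * A * H⁻¹ * (Aᵀ * X⁻¹)) z =
      qf X⁻¹ z + qf H (H⁻¹ *ᵥ ((Aᵀ * X⁻¹) *ᵥ z)) := by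
    have ht : X⁻¹ * A = (Aᵀ * X⁻¹)ᵀ := by rw [transpose_mul, hXs.eq, transpose_transpose]
    simp only [qf, add_mulVec, dotProduct_add, hHb]
    rw [ht, ← mulVec_mulVec, ← mulVec_mulVec, dotProduct_mulVec z (Aᵀ * X⁻¹)ᵀ, vecMul_transpose,
      dotProduct_comm ((Aᵀ * X⁻¹) *ᵥ z)]
  rw [hS, hHb, neg_dotProduct, hcross]
  ring

/-- (Lemma 2, quadratic maximization identity.) If `Aᵀ X⁻¹ A − γ² Y⁻¹ ≺ 0`, then
`max_v ( |x − A v|²_{X⁻¹} − γ² |y − v|²_{Y⁻¹} ) = |x − A y|²_{(X − γ⁻² A Y Aᵀ)⁻¹}`,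
the maximum being attained. -/
theorem quadratic_maximization_identity {n m : ℕ}
    (x : Fin n → ℝ) (y : Fin m → ℝ)
    (A : Matrix (Fin n) (Fin m) ℝ)
    (X : Matrix (Fin n) (Fin n) ℝ) (Y : Matrix (Fin m) (Fin m) ℝ)
    (hX : X.PosDef) (hY : Y.PosDef) (γ : ℝ) (hγ : 0 < γ)
    (hconc : (γ ^ 2 • Y⁻¹ - Aᵀ * X⁻¹ * A).PosDef) :
    IsGreatest
      (Set.range fun v : Fin m → ℝ => qf X⁻¹ (x - A *ᵥ v) - γ ^ 2 * qf Y⁻¹ (y - v))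
      (qf (X - (γ ^ 2)⁻¹ • (A * Y * Aᵀ))⁻¹ (x - A *ᵥ y)) := by
  have hsq := fun v => sub_qf_eq_sub_qf_completed_square x y v A hX hY (pow_pos hγ 2).ne' hconc
  constructor
  · refine ⟨y - (γ ^ 2 • Y⁻¹ - Aᵀ * X⁻¹ * A)⁻¹ *ᵥ ((Aᵀ * X⁻¹) *ᵥ (x - A *ᵥ y)), ?_⟩
    simp only [hsq]
    simp [qf]
  · rintro _ ⟨v, rfl⟩
    simp only [hsq]
    exact sub_le_self _ (qf_nonneg hconc _)
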